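/- For every integer n ≥ 3, the set {u_{1,i}, u_{2,i} : 0 ≤ i ≤ n−1} is a minimal total dominating set of the Cartesian product C_4 □ C_n; consequently Γ_t(C_4 □ C_n) ≥ 2n. -/

import Mathlib

/-- `S` is a total dominating set of `G`: every vertex of `G` is adjacent to a vertex
of `S`. -/
def IsTotalDominatingSet {V : Type*} (G : SimpleGraph V) (S : Set V) : Prop :=
  ∀ v : V, ∃ u ∈ S, G.Adj u v

/-- `S` is a minimal total dominating set of `G`: a total dominating set no proper subset
of which is a total dominating set. -/
def IsMinimalTotalDominatingSet {V : Type*} (G : SimpleGraph V) (S : Set V) : Prop :=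
  IsTotalDominatingSet G S ∧ ∀ T : Set V, T ⊂ S → ¬ IsTotalDominatingSet G T

/-- The upper total domination number of `G`: maximum cardinality of a minimal total
dominating set. -/
noncomputable def upperTotalDominationNumber {V : Type*} [Fintype V] (G : SimpleGraph V) : ℕ :=
  sSup {m | ∃ S : Set V, IsMinimalTotalDominatingSet G S ∧ S.ncard = m}

theorem IsMinimalTotalDominatingSet.ncard_le_upperTotalDominationNumber {V : Type*} [Fintype V]
    {G : SimpleGraph V} {S : Set V} (hS : IsMinimalTotalDominatingSet G S) :
    S.ncard ≤ upperTotalDominationNumber G := by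
  refine le_csSup ⟨Nat.card V, ?_⟩ ⟨S, hS, rfl⟩
  rintro m ⟨T, -, rfl⟩
  exact Set.ncard_le_card T

/-- A total dominating set is minimal if each of its vertices is the only vertex of the set
adjacent to some vertex of the graph. -/
theorem IsTotalDominatingSet.isMinimal_of_private_neighbor {V : Type*} {G : SimpleGraph V}
    {S : Set V} (hS : IsTotalDominatingSet G S)
    (hpriv : ∀ u ∈ S, ∃ v, ∀ w ∈ S, G.Adj w v → w = u) :
    IsMinimalTotalDominatingSet G S := by
  refine ⟨hS, fun T hT hTD => ?_⟩
  obtain ⟨u, huS, huT⟩ := Set.exists_of_ssubset hT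
  obtain ⟨v, hv⟩ := hpriv u huS
  obtain ⟨w, hwT, hwv⟩ := hTD v
  exact huT (hv w (hT.1 hwT) hwv ▸ hwT)

/-- In the product of `C₄` with any graph, two consecutive rows form a minimal total
dominating set. -/
theorem isMinimalTotalDominatingSet_cycleGraph_four_boxProd {W : Type*} (H : SimpleGraph W) :
    IsMinimalTotalDominatingSet ((SimpleGraph.cycleGraph 4).boxProd H)
      {p : Fin 4 × W | p.1 = 1 ∨ p.1 = 2} := by
  have hdom : ∀ a : Fin 4, ∃ b : Fin 4,
      (b = 1 ∨ b = 2) ∧ (SimpleGraph.cycleGraph 4).Adj b a := by decide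
  have hpriv : ∀ a : Fin 4, (a = 1 ∨ a = 2) → ∃ b : Fin 4, ¬ (b = 1 ∨ b = 2) ∧
      ∀ c : Fin 4, (c = 1 ∨ c = 2) → (SimpleGraph.cycleGraph 4).Adj c b → c = a := by decide
  refine IsTotalDominatingSet.isMinimal_of_private_neighbor ?_ ?_
  · rintro ⟨a, x⟩
    obtain ⟨b, hb, hba⟩ := hdom a
    exact ⟨(b, x), hb, SimpleGraph.boxProd_adj.2 (Or.inl ⟨hba, rfl⟩)⟩
  · rintro ⟨a, x⟩ ha
    obtain ⟨b, hb, hba⟩ := hpriv a ha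
    refine ⟨(b, x), ?_⟩
    rintro ⟨c, y⟩ hc hadj
    rcases SimpleGraph.boxProd_adj.1 hadj with ⟨hcb, hyx⟩ | ⟨-, hcb⟩
    · exact Prod.ext (hba c hc hcb) hyx
    · obtain rfl : c = b := hcb
      exact absurd hc hb

theorem ncard_rows_one_two (n : ℕ) :
    {p : Fin 4 × Fin n | p.1 = 1 ∨ p.1 = 2}.ncard = 2 * n := by
  have h : {p : Fin 4 × Fin n | p.1 = 1 ∨ p.1 = 2} =
      ({1, 2} : Set (Fin 4)) ×ˢ (Set.univ : Set (Fin n)) := by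
    ext p
    simp
  rw [h, Set.ncard_prod, Set.ncard_pair (by decide), Set.ncard_univ, Nat.card_fin]

/-- For every `n ≥ 3`, the set `{u_{1,i}, u_{2,i} : 0 ≤ i ≤ n-1}` (rows
`1` and `2`) is a minimal total dominating set of `C₄ □ Cₙ`; consequently the upper total
domination number of `C₄ □ Cₙ` is at least `2n`. -/
theorem rows_one_two_minimal_TDset_C4_boxProd_Cn (n : ℕ) (hn : 3 ≤ n) :
    IsMinimalTotalDominatingSet
      ((SimpleGraph.cycleGraph 4).boxProd (SimpleGraph.cycleGraph n))
      {p : Fin 4 × Fin n | p.1 = 1 ∨ p.1 = 2} ∧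
    2 * n ≤ upperTotalDominationNumber
      ((SimpleGraph.cycleGraph 4).boxProd (SimpleGraph.cycleGraph n)) := by
  have hmin := isMinimalTotalDominatingSet_cycleGraph_four_boxProd (SimpleGraph.cycleGraph n)
  exact ⟨hmin, (ncard_rows_one_two n).symm.le.trans hmin.ncard_le_upperTotalDominationNumber⟩
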